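/- For every real x ≥ 1, exp(1/(240x^3) - 11/(6720x^5)) < e^x · Γ(x+1) / (x^x · √(2πx) · exp(ψ'(x+1/2)/12)). -/

import Mathlib

open Real Filter Topology

noncomputable def trigamma (x : ℝ) : ℝ :=
  iteratedDeriv 2 (fun y => Real.log (Real.Gamma y)) x

theorem key_rat (x : ℝ) (hx : 1 ≤ x) :
    (1 / (240 * x ^ 3) - 11 / (6720 * x ^ 5))
      - (1 / (240 * (x+1) ^ 3) - 11 / (6720 * (x+1) ^ 5))
      < (1/(2*x+1))^4/5 + (1/(2*x+1))^6/7+ (1/(2*x+1))^8/9 := by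
  obtain ⟨s, hs, rfl⟩ : ∃ s : ℝ, 0 ≤ s ∧ x = s + 1 := ⟨x-1, by linarith, by ring⟩
  rw [← sub_pos]
  have h1 : s + 1 ≠ 0 := by positivity
  have h2 : s + 1 + 1 ≠ 0 := by positivity
  have h3 : 2 * (s + 1) + 1 ≠ 0 := by positivity
  have e : (1/(2*(s+1)+1))^4/5 + (1/(2*(s+1)+1))^6/7+ (1/(2*(s+1)+1))^8/9
      - ((1 / (240 * (s+1) ^ 3) - 11 / (6720 * (s+1) ^ 5))
        - (1 / (240 * (s+1+1) ^ 3) - 11 / (6720 * (s+1+1) ^ 5)))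
      = ((1/5*(2*(s+1)+1)^4 + 1/7*(2*(s+1)+1)^2 + 1/9)*((s+1)^5*(s+1+1)^5)
        - (2*(s+1)+1)^8*((s+1+1)^5*((s+1)^2/240-11/6720)
          - (s+1)^5*((s+1+1)^2/240-11/6720)))
        / ((2*(s+1)+1)^8*((s+1)^5*(s+1+1)^5)) := by
    field_simp
  rw [e]
  apply div_pos _ (by positivity)
  ring_nf
  positivity

theorem log_lower (x : ℝ) (hx : 1 ≤ x) :
    1 + (1/(2*x+1))^2/3 + ((1/(2*x+1))^4/5 + (1/(2*x+1))^6/7 + (1/(2*x+1))^8/9)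
      ≤ (x + 1/2) * (Real.log (x+1) - Real.log x) := by
  have h0 : (0:ℝ) < x := by linarith
  have h := Real.hasSum_log_one_add_inv h0
  have h1 := sum_le_hasSum (Finset.range 5) (fun k _ => by positivity) h
  have e : Real.log (1 + x⁻¹) = Real.log (x+1) - Real.log x := by
    rw [← Real.log_div (by positivity) h0.ne']
    congr 1
    field_simp
  rw [e] at h1
  refine le_trans (le_of_eq ?_) (mul_le_mul_of_nonneg_left h1 (by positivity : 0 ≤ x + 1/2))
  have h3 : 2 * x + 1 ≠ 0 := by positivity
  have hh : x + 1/2 = (1/2) * (1/(2*x+1))⁻¹ := by field_simp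
  rw [hh]
  have hu : (1/(2*x+1)) ≠ 0 := by positivity
  generalize 1/(2*x+1) = u at hu
  simp only [Finset.sum_range_succ, Finset.sum_range_zero]
  push_cast
  field_simp
  ring

noncomputable def lg (y : ℝ) : ℝ := Real.log (Real.Gamma y)

theorem lg_analytic {y : ℝ} (hy : 0 < y) : AnalyticAt ℝ lg y := by
  have h1 : AnalyticAt ℂ Complex.Gamma (y : ℂ) := by
    have ho : IsOpen {s : ℂ | 0 < s.re} := Complex.continuous_re.isOpen_preimage _ isOpen_Ioi
    refine DifferentiableOn.analyticAt (s := {s : ℂ | 0 < s.re}) ?_ (ho.mem_nhds (by simpa using hy))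
    intro s hs
    refine (Complex.differentiableAt_Gamma s ?_).differentiableWithinAt
    rintro m rfl
    simp at hs
    have : (0:ℝ) ≤ m := Nat.cast_nonneg m
    linarith
  have h2 : AnalyticAt ℝ Real.Gamma y := h1.re_ofReal
  exact h2.log (Real.Gamma_pos_of_pos hy)

theorem lg_add_one {y : ℝ} (hy : 0 < y) : lg (y + 1) = lg y + Real.log y := by
  unfold lg
  rw [Real.Gamma_add_one hy.ne', Real.log_mul hy.ne' (Real.Gamma_pos_of_pos hy).ne', add_comm]

theorem dlg_add_one {y : ℝ} (hy : 0 < y) : deriv lg (y + 1) = deriv lg y + 1 / y := by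
  have e : (fun z => lg (z + 1)) =ᶠ[𝓝 y] fun z => lg z + Real.log z := by
    filter_upwards [lt_mem_nhds hy] with z hz using lg_add_one hz
  have h := e.deriv_eq
  rw [deriv_comp_add_const] at h
  rw [h, deriv_fun_add (lg_analytic hy).differentiableAt (Real.differentiableAt_log hy.ne'),
    Real.deriv_log, one_div]

theorem trigamma_eq : trigamma = deriv (deriv lg) := by
  funext y
  unfold trigamma
  rw [iteratedDeriv_succ, iteratedDeriv_one]
  rfl

theorem trigamma_add_one {y : ℝ} (hy : 0 < y) : trigamma (y + 1) = trigamma y - 1 / y ^ 2 := by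
  rw [trigamma_eq]
  have e : (fun z => deriv lg (z + 1)) =ᶠ[𝓝 y] fun z => deriv lg z + z⁻¹ := by
    filter_upwards [lt_mem_nhds hy] with z hz
    rw [dlg_add_one hz, one_div]
  have h := e.deriv_eq
  rw [deriv_comp_add_const] at h
  rw [h, deriv_fun_add (lg_analytic hy).deriv.differentiableAt (differentiableAt_inv hy.ne'),
    deriv_inv]
  simp [sub_eq_add_neg]

theorem dlg_mono : MonotoneOn (deriv lg) (Set.Ioi 0) := by
  have h : ConvexOn ℝ (Set.Ioi 0) lg := Real.convexOn_log_Gamma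
  exact h.monotoneOn_deriv (fun y hy => (lg_analytic hy).differentiableAt)

theorem trigamma_nonneg {y : ℝ} (hy : 0 < y) : 0 ≤ trigamma y := by
  rw [trigamma_eq]
  by_contra! hneg
  have h := dlg_mono.derivWithin_nonneg (x := y)
  rw [derivWithin_of_isOpen isOpen_Ioi hy] at h
  linarith

theorem trigamma_cmp {z y : ℝ} (hz : 0 < z) (hzy : z ≤ y) (n : ℕ) :
    trigamma (z + n) - trigamma z ≤ trigamma (y + n) - trigamma y := by
  induction n with
  | zero => simp
  | succ n ih =>
    have hn : (0:ℝ) ≤ n := Nat.cast_nonneg n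
    have h1 : trigamma (z + (n + 1 : ℕ)) = trigamma (z + n) - 1 / (z + n) ^ 2 := by
      rw [← trigamma_add_one (by positivity)]; push_cast; ring_nf
    have h2 : trigamma (y + (n + 1 : ℕ)) = trigamma (y + n) - 1 / (y + n) ^ 2 := by
      rw [← trigamma_add_one (by linarith)]; push_cast; ring_nf
    have h3 : 1 / (y + n) ^ 2 ≤ 1 / (z + n) ^ 2 := by gcongr
    rw [h1, h2]
    linarith

theorem trigamma_tendsto {z : ℝ} (hz : 0 < z) :
    Tendsto (fun n : ℕ => trigamma (z + n)) atTop (𝓝 0) := by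
  rw [Metric.tendsto_atTop]
  intro ε hε
  have hc : ContinuousAt trigamma z := by
    rw [trigamma_eq]; exact (lg_analytic hz).deriv.deriv.continuousAt
  obtain ⟨δ0, hδ0, hδ⟩ := Metric.continuousAt_iff.1 hc (ε / 2) (by positivity)
  set δ := min (δ0 / 2) 1 with hδdef
  have hδpos : 0 < δ := by positivity
  have hδ1 : δ ≤ 1 := min_le_right _ _
  have hδ2 : δ < δ0 := lt_of_le_of_lt (min_le_left _ _) (by linarith)
  obtain ⟨N, hN⟩ := exists_nat_gt (2 / (ε * δ))
  refine ⟨N, fun n hn => ?_⟩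
  have hn0 : (0:ℝ) ≤ n := Nat.cast_nonneg n
  have hnN : (N:ℝ) ≤ n := by exact_mod_cast hn
  rw [Real.dist_eq, sub_zero, abs_of_nonneg (trigamma_nonneg (by positivity))]
  have hpos : ∀ w ∈ Set.Icc (z + n) (z + n + δ), 0 < w := fun w hw => by
    have := hw.1
    linarith
  obtain ⟨c, hcm, hceq⟩ := exists_deriv_eq_slope (deriv lg) (a := z + n) (b := z + n + δ)
    (by linarith)
    (fun w hw => (lg_analytic (hpos w hw)).deriv.continuousAt.continuousWithinAt)
    (fun w hw => (lg_analytic (hpos w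
      (Set.Ioo_subset_Icc_self hw))).deriv.differentiableAt.differentiableWithinAt)
  have h1 := trigamma_cmp (y := c - n) hz (by linarith [hcm.1]) n
  have h2 := hδ (x := c - n) (by
    rw [Real.dist_eq, abs_lt]; constructor <;> linarith [hcm.1, hcm.2])
  rw [Real.dist_eq, abs_lt] at h2
  rw [← trigamma_eq] at hceq
  rw [sub_add_cancel, hceq] at h1
  have h3 : deriv lg (z + n + δ) ≤ deriv lg (z + n) + 1 / (z + n) := by
    rw [← dlg_add_one (by positivity)]
    refine dlg_mono (Set.mem_Ioi.2 (by positivity)) (Set.mem_Ioi.2 (by positivity)) (by linarith)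
  have h4 : (deriv lg (z + n + δ) - deriv lg (z + n)) / (z + n + δ - (z + n)) < ε / 2 := by
    have e : z + n + δ - (z + n) = δ := by ring
    rw [e, div_lt_iff₀ hδpos]
    have h5 : 1 / (z + n) < ε / 2 * δ := by
      rw [div_lt_iff₀ (by positivity)]
      rw [div_lt_iff₀ (by positivity)] at hN
      have : (N:ℝ) * (ε * δ) ≤ (z + n) * (ε * δ) := by
        apply mul_le_mul_of_nonneg_right _ (by positivity)
        linarith
      linarith
    linarith
  linarith [h2.1]

noncomputable def RR (x : ℝ) : ℝ := 1 / (240 * x ^ 3) - 11 / (6720 * x ^ 5)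

noncomputable def FF (x : ℝ) : ℝ :=
  x + lg (x + 1) - x * Real.log x - (Real.log (2 * π) + Real.log x) / 2
    - trigamma (x + 1/2) / 12 - RR x

theorem FF_step (x : ℝ) (hx : 1 ≤ x) : FF (x + 1) < FF x := by
  have h1 := key_rat x hx
  have h2 := log_lower x hx
  have h3 := lg_add_one (y := x + 1) (by linarith)
  have h4 := trigamma_add_one (y := x + 1/2) (by linarith)
  have e1 : x + 1 + 1/2 = x + 1/2 + 1 := by ring
  have e2 : 1 / (x + 1/2)^2 / 12 = (1/(2*x+1))^2/3 := by
    have : 2 * x + 1 ≠ 0 := by positivity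
    have h' : x + 1/2 = (2*x+1)/2 := by ring
    rw [h']
    field_simp
    norm_num
  unfold FF RR
  rw [e1, h3, h4]
  linarith

theorem RR_tendsto (x : ℝ) : Tendsto (fun n : ℕ => RR (x + n)) atTop (𝓝 0) := by
  have h : Tendsto (fun n : ℕ => x + (n:ℝ)) atTop atTop :=
    tendsto_atTop_add_const_left _ _ tendsto_natCast_atTop_atTop
  have h3 : Tendsto (fun n : ℕ => ((x + (n:ℝ))^3)⁻¹) atTop (𝓝 0) :=
    tendsto_inv_atTop_zero.comp ((tendsto_pow_atTop (by norm_num)).comp h)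
  have h5 : Tendsto (fun n : ℕ => ((x + (n:ℝ))^5)⁻¹) atTop (𝓝 0) :=
    tendsto_inv_atTop_zero.comp ((tendsto_pow_atTop (by norm_num)).comp h)
  have := (h3.const_mul (1/240)).sub (h5.const_mul (11/6720))
  simp only [mul_zero, sub_zero] at this
  refine this.congr (fun n => ?_)
  unfold RR
  rw [← div_div, ← div_div]
  rfl

theorem FF_nonneg (x : ℝ) (hx : 1 ≤ x) : 0 ≤ FF (x + 1) := by
  have hx0 : 0 < x := by linarith
  have hA := (Real.BohrMollerup.tendsto_log_gamma hx0)
  have hB : Tendsto (fun n : ℕ => (n:ℝ) * Real.log (1 + x / n)) atTop (𝓝 x) :=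
    (Real.tendsto_mul_log_one_add_div_atTop x).comp tendsto_natCast_atTop_atTop
  have hC : Tendsto (fun n : ℕ => Real.log (1 + x / n)) atTop (𝓝 0) := by
    have h0 : Tendsto (fun n : ℕ => 1 + x / (n:ℝ)) atTop (𝓝 1) := by
      simpa using (tendsto_const_div_atTop_nhds_zero_nat x).const_add 1
    simpa using h0.log one_ne_zero
  have hD := trigamma_tendsto (z := x + 1/2) (by linarith)
  have hE := RR_tendsto x
  have hlim := (((((tendsto_const_nhds (x := lg x)).sub hA).add
    (((tendsto_const_nhds (x := x)).sub hB).sub (hC.const_mul x))).sub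
      (hC.const_mul (1/2))).sub (hD.const_mul (1/12))).sub hE
  have hz : lg x - Real.log (Real.Gamma x) + (x - x - x * 0) - 1 / 2 * 0 - 1 / 12 * 0 - 0 = 0 := by
    unfold lg; ring
  rw [hz] at hlim
  have hmono : ∀ n : ℕ, FF (x + (n + 1 : ℕ)) ≤ FF (x + 1) := by
    intro n
    induction n with
    | zero => simp
    | succ n ih =>
      have hn0 : (0:ℝ) ≤ n := Nat.cast_nonneg n
      have := FF_step (x + (n + 1 : ℕ)) (by push_cast; linarith)
      refine le_trans (le_of_eq ?_) (this.le.trans ih)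
      push_cast
      ring_nf
  refine le_of_tendsto hlim ?_
  filter_upwards [eventually_ge_atTop 1] with n hn
  have hnpos : (0:ℝ) < n := by exact_mod_cast hn
  refine le_trans ?_ (?_ : FF (x + n) ≤ FF (x + 1))
  · have h1 := Real.BohrMollerup.f_add_nat_eq (f := lg) (fun {y} hy => lg_add_one hy) hx0 (n + 1)
    have h2 := Stirling.le_log_factorial_stirling (n := n) (by omega)
    have h3 : Real.log (x + n) = Real.log n + Real.log (1 + x / n) := by
      rw [← Real.log_mul (by positivity) (by positivity)]
      congr 1
      field_simp
      ring
    have e1 : x + ((n + 1 : ℕ) : ℝ) = x + n + 1 := by push_cast; ring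
    have e2 : x + n + 1/2 = x + 1/2 + n := by ring
    rw [e1] at h1
    unfold FF Real.BohrMollerup.logGammaSeq
    rw [e2, h1, h3]
    linarith
  · obtain ⟨m, rfl⟩ : ∃ m, n = m + 1 := ⟨n - 1, by omega⟩
    exact hmono m

theorem stmt3 (x : ℝ) (hx : 1 ≤ x) :
    Real.exp (1 / (240 * x ^ 3) - 11 / (6720 * x ^ 5)) <
    Real.exp x * Real.Gamma (x + 1) /
      (x ^ x * Real.sqrt (2 * Real.pi * x) * Real.exp (trigamma (x + 1/2) / 12)) := by
  have hx0 : 0 < x := by linarith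
  have hF : 0 < FF x := lt_of_le_of_lt (FF_nonneg x hx) (FF_step x hx)
  have hG : 0 < Real.Gamma (x + 1) := Real.Gamma_pos_of_pos (by linarith)
  have hp : 0 < x ^ x := Real.rpow_pos_of_pos hx0 x
  have hpi := Real.pi_pos
  have hs : 0 < Real.sqrt (2 * Real.pi * x) := Real.sqrt_pos.2 (by positivity)
  rw [← Real.lt_log_iff_exp_lt (by positivity)]
  rw [Real.log_div (by positivity) (by positivity), Real.log_mul (by positivity) (by positivity),
    Real.log_mul (by positivity) (by positivity), Real.log_mul (by positivity) (by positivity),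
    Real.log_exp, Real.log_exp, Real.log_rpow hx0, Real.log_sqrt (by positivity),
    Real.log_mul (by positivity) (by positivity)]
  unfold FF RR lg at hF
  linarith
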